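/- Let μ be a distribution on Q_d and let S ⊆ {1,...,d} be such that w_i^0 = 1/2 for all i ∈ S and w_i^0 > 1/2 for all i ∉ S. If (A,B) is an equilibrium for the two-player Voronoi game on Q_d with distribution μ, then a_i = b_i = 0 for every coordinate i ∉ S (i.e. both A and B lie in the majority subcube {X ∈ Q_d : x_i = 0 for all i ∉ S}). -/

import Mathlib

open Finset

/-- Hamming distance on the hypercube `{0,1}^d` (modelled as `Fin d → Bool`). -/
def hamming {d : ℕ} (X Y : Fin d → Bool) : ℕ :=
  (Finset.univ.filter (fun i => X i ≠ Y i)).card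

/-- Number of 1-coordinates of a point of the hypercube. -/
def nOnes {d : ℕ} (X : Fin d → Bool) : ℕ :=
  (Finset.univ.filter (fun i => X i = true)).card

/-- `μ` is a probability distribution on the hypercube. -/
def IsDistribution {d : ℕ} (μ : (Fin d → Bool) → ℝ) : Prop :=
  (∀ X, 0 ≤ μ X) ∧ ∑ X : Fin d → Bool, μ X = 1

open Classical in
/-- The weight of a set of points under `μ`. -/
noncomputable def wt {d : ℕ} (μ : (Fin d → Bool) → ℝ) (S : Set (Fin d → Bool)) : ℝ :=
  ∑ X : Fin d → Bool, if X ∈ S then μ X else 0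

/-- Payoff to player 1, positioned at `A`, against player 2 positioned at `B`. -/
noncomputable def P1 {d : ℕ} (μ : (Fin d → Bool) → ℝ) (A B : Fin d → Bool) : ℝ :=
  wt μ {X | hamming X A < hamming X B} + (1/2) * wt μ {X | hamming X A = hamming X B}

/-- Payoff to player 2, positioned at `B`, against player 1 positioned at `A`. -/
noncomputable def P2 {d : ℕ} (μ : (Fin d → Bool) → ℝ) (A B : Fin d → Bool) : ℝ :=
  wt μ {X | hamming X B < hamming X A} + (1/2) * wt μ {X | hamming X A = hamming X B}

/-- `(A,B)` is an equilibrium: neither player can strictly improve by moving. -/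
def IsEquilibrium {d : ℕ} (μ : (Fin d → Bool) → ℝ) (A B : Fin d → Bool) : Prop :=
  (∀ A', P1 μ A' B ≤ P1 μ A B) ∧ (∀ B', P2 μ A B' ≤ P2 μ A B)

/-- `w_i^0`: the weight of the subcube where coordinate `i` equals 0. -/
noncomputable def w0 {d : ℕ} (μ : (Fin d → Bool) → ℝ) (i : Fin d) : ℝ :=
  wt μ {X | X i = false}

/-- The all-zeros point `𝟎`. -/
def zeroPt (d : ℕ) : Fin d → Bool := fun _ => false

/-- The all-ones point `𝟏`. -/
def onePt (d : ℕ) : Fin d → Bool := fun _ => true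

lemma hamming_update_lt {d : ℕ} {X B : Fin d → Bool} {i : Fin d} (h : X i ≠ B i) :
    hamming X (Function.update B i (X i)) < hamming X B := by
  apply Finset.card_lt_card
  rw [Finset.ssubset_iff_of_subset]
  · exact ⟨i, by simpa using h, by simp⟩
  · intro j hj
    by_cases hji : j = i
    · subst hji
      simpa using h
    · simpa [hji] using hj

lemma wt_nonneg {d : ℕ} {μ : (Fin d → Bool) → ℝ} (hμ : ∀ X, 0 ≤ μ X)
    (s : Set (Fin d → Bool)) : 0 ≤ wt μ s := by
  classical
  exact Finset.sum_nonneg fun X _ => by split_ifs <;> simp [hμ X]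

lemma wt_mono {d : ℕ} {μ : (Fin d → Bool) → ℝ} (hμ : ∀ X, 0 ≤ μ X)
    {s t : Set (Fin d → Bool)} (hst : s ⊆ t) : wt μ s ≤ wt μ t := by
  classical
  refine Finset.sum_le_sum fun X _ => ?_
  by_cases hs : X ∈ s
  · simp [hs, hst hs]
  · rw [if_neg hs]
    split_ifs <;> simp [hμ X]

lemma P1_add_P2 {d : ℕ} {μ : (Fin d → Bool) → ℝ} (hμ : IsDistribution μ)
    (A B : Fin d → Bool) : P1 μ A B + P2 μ A B = 1 := by
  rw [← hμ.2]
  simp only [P1, P2, wt, Finset.mul_sum, ← Finset.sum_add_distrib, Set.mem_ofPred_eq]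
  refine Finset.sum_congr rfl fun X _ => ?_
  rcases lt_trichotomy (hamming X A) (hamming X B) with h | h | h
  · simp [h, h.ne, h.not_gt]
  · simp only [h, lt_irrefl, if_true, if_false]
    ring
  · simp [h, h.ne', h.not_gt]

lemma P2_eq_P1_swap {d : ℕ} (μ : (Fin d → Bool) → ℝ) (A B : Fin d → Bool) :
    P2 μ A B = P1 μ B A := by
  simp only [P1, P2, eq_comm]

lemma P1_self {d : ℕ} {μ : (Fin d → Bool) → ℝ} (hμ : IsDistribution μ)
    (A : Fin d → Bool) : P1 μ A A = 1 / 2 := by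
  have h := P1_add_P2 hμ A A
  rw [P2_eq_P1_swap] at h
  linarith

lemma w0_le_P1_update {d : ℕ} {μ : (Fin d → Bool) → ℝ} (hμ : ∀ X, 0 ≤ μ X)
    {B : Fin d → Bool} {i : Fin d} (hB : B i = true) :
    w0 μ i ≤ P1 μ (Function.update B i false) B := by
  have hsub : {X : Fin d → Bool | X i = false} ⊆
      {X | hamming X (Function.update B i false) < hamming X B} := by
    intro X (hX : X i = false)
    have h := hamming_update_lt (X := X) (B := B) (i := i) (by simp [hX, hB])
    rwa [hX] at h
  have h₁ := wt_mono hμ hsub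
  have h₂ := wt_nonneg hμ {X | hamming X (Function.update B i false) = hamming X B}
  unfold w0 P1
  linarith

/-- If every reply to `B` earns at most one half, `B` follows the strict majority. -/
lemma eq_false_of_P1_le_half {d : ℕ} {μ : (Fin d → Bool) → ℝ} (hμ : ∀ X, 0 ≤ μ X)
    {B : Fin d → Bool} (hB : ∀ A, P1 μ A B ≤ 1 / 2) {i : Fin d} (hi : 1 / 2 < w0 μ i) :
    B i = false := by
  by_contra h
  have h₁ := w0_le_P1_update hμ (Bool.eq_true_of_not_eq_false h)
  linarith [hB (Function.update B i false)]

theorem statement_12 (d : ℕ) (μ : (Fin d → Bool) → ℝ) (hμ : IsDistribution μ)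
    (S : Set (Fin d)) (hS : ∀ i ∈ S, w0 μ i = 1/2) (hS' : ∀ i ∉ S, (1:ℝ)/2 < w0 μ i)
    (A B : Fin d → Bool) (hAB : IsEquilibrium μ A B) :
    ∀ i ∉ S, A i = false ∧ B i = false := by
  obtain ⟨h₁, h₂⟩ := hAB
  have hsum := P1_add_P2 hμ A B
  have hA := P1_self hμ A
  have hB := h₁ B
  rw [P1_self hμ B] at hB
  have hA' := h₂ A
  rw [P2_eq_P1_swap, hA] at hA'
  intro i hi
  refine ⟨eq_false_of_P1_le_half hμ.1 (fun C => ?_) (hS' i hi),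
    eq_false_of_P1_le_half hμ.1 (fun C => ?_) (hS' i hi)⟩
  · rw [← P2_eq_P1_swap]
    linarith [h₂ C]
  · linarith [h₁ C]
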